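/- arXiv:0905.1975 — 4 statements merged into one kernel-verified Lean document; each statement's English description precedes it below -/
import Mathlib

section
/- Let h : ℝ → ℝ be continuous with h(u) > 0 for all u, and for t ≤ s set Γ(t,s) = ∫_t^s h(u)² du. Fix t ∈ ℝ and x ∈ ℝ. Then the Gaussian kernel G(s,y) := (2π Γ(t,s))^{-1/2} · exp(−(y−x)²/(2Γ(t,s))) satisfies the forward equation ∂G/∂s(s,y) = (1/2) h(s)² ∂²G/∂y²(s,y) for all s > t and all y ∈ ℝ. -/
/-- The Gaussian density with mean `x` and variance `v`, evaluated at `y`. -/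
noncomputable def heatKernel (x v y : ℝ) : ℝ :=
  (Real.sqrt (2 * Real.pi * v))⁻¹ * Real.exp (-(y - x) ^ 2 / (2 * v))

theorem hasDerivAt_heatKernel_variance (x y : ℝ) {v : ℝ} (hv : 0 < v) :
    HasDerivAt (fun v' => heatKernel x v' y)
      ((1 / 2) * (((y - x) ^ 2 / v ^ 2 - 1 / v) * heatKernel x v y)) v := by
  have hpos : 0 < 2 * Real.pi * v := by positivity
  have hsqrt : HasDerivAt (fun v' => (Real.sqrt (2 * Real.pi * v'))⁻¹) _ v :=
    (((hasDerivAt_id v).const_mul (2 * Real.pi)).sqrt hpos.ne').inv (Real.sqrt_pos.2 hpos).ne'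
  have hexp : HasDerivAt (fun v' => Real.exp (-(y - x) ^ 2 / (2 * v'))) _ v :=
    ((hasDerivAt_const v (-(y - x) ^ 2)).div ((hasDerivAt_id v).const_mul 2)
      (by simpa using hv.ne')).exp
  refine (hsqrt.mul hexp).congr_deriv ?_
  have hsq : Real.sqrt (2 * Real.pi * v) ^ 2 = 2 * Real.pi * v := Real.sq_sqrt hpos.le
  simp only [heatKernel, id, Pi.div_apply]
  rw [hsq]
  field_simp
  ring

theorem hasDerivAt_heatKernel_space (x v y : ℝ) :
    HasDerivAt (heatKernel x v) (-(y - x) / v * heatKernel x v y) y := by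
  have hexp := ((((hasDerivAt_id y).sub_const x).pow 2).neg.div_const (2 * v)).exp.const_mul
    (Real.sqrt (2 * Real.pi * v))⁻¹
  refine hexp.congr_deriv ?_
  simp only [heatKernel, id, Pi.pow_apply, Pi.neg_apply]
  field_simp
  ring

theorem iteratedDeriv_two_heatKernel (x v y : ℝ) :
    iteratedDeriv 2 (heatKernel x v) y =
      ((y - x) ^ 2 / v ^ 2 - 1 / v) * heatKernel x v y := by
  have hderiv : deriv (heatKernel x v) = fun y' => -(y' - x) / v * heatKernel x v y' :=
    funext fun y' => (hasDerivAt_heatKernel_space x v y').deriv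
  rw [iteratedDeriv_succ, iteratedDeriv_one, hderiv]
  have hsecond := (((hasDerivAt_id y).sub_const x).neg.div_const v).mul
    (hasDerivAt_heatKernel_space x v y)
  refine (hsecond.congr_deriv ?_).deriv
  simp only [id, Pi.neg_apply]
  ring

/-- The Gaussian kernel `G(s,y) = (2π Γ(t,s))^{-1/2} exp(−(y−x)²/(2Γ(t,s)))`,
with `Γ(t,s) = ∫_t^s h(u)² du`, satisfies the forward equation
`∂G/∂s = (1/2) h(s)² ∂²G/∂y²` for all `s > t` and all `y`. -/
theorem gaussian_kernel_forward_equation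
    (h : ℝ → ℝ) (hc : Continuous h) (hpos : ∀ u, 0 < h u)
    (t x : ℝ)
    (G : ℝ → ℝ → ℝ)
    (hG : ∀ s y, G s y =
      (Real.sqrt (2 * Real.pi * ∫ u in t..s, (h u) ^ 2))⁻¹ *
        Real.exp (-(y - x) ^ 2 / (2 * ∫ u in t..s, (h u) ^ 2))) :
    ∀ s, t < s → ∀ y : ℝ,
      deriv (fun s' => G s' y) s
        = (1 / 2) * (h s) ^ 2 * iteratedDeriv 2 (fun y' => G s y') y := by
  intro s hs y
  have hcont : Continuous fun u => h u ^ 2 := hc.pow 2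
  have hvar : 0 < ∫ u in t..s, h u ^ 2 :=
    intervalIntegral.intervalIntegral_pos_of_pos (hcont.intervalIntegrable t s)
      (fun u => pow_pos (hpos u) 2) hs
  have htime : HasDerivAt (fun s' => ∫ u in t..s', h u ^ 2) (h s ^ 2) s :=
    hcont.integral_hasStrictDerivAt t s |>.hasDerivAt
  have hG' : ∀ s' y', G s' y' = heatKernel x (∫ u in t..s', h u ^ 2) y' := hG
  have hcomp := (hasDerivAt_heatKernel_variance x y hvar).comp s htime
  simp only [Function.comp_def] at hcomp
  simp only [hG']
  rw [hcomp.deriv, iteratedDeriv_two_heatKernel]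
  ring
end

section
/- Let h : ℝ → ℝ be continuous with h(u) > 0 for all u, fix s > 0, and for τ < s set Γ(τ,s) = ∫_τ^s h(u)² du. Suppose v₁ : (0,s) × (0,∞) → ℝ is continuously differentiable in τ and twice continuously differentiable in y and satisfies ∂v₁/∂τ(τ,y) = (1/2) h(τ)² ∂²v₁/∂y²(τ,y) − h(τ)² (1/y) ∂v₁/∂y(τ,y) + h(τ)² (1/y² + 1/Γ(τ,s)) v₁(τ,y). Then for any constant c, v'(τ,y) := v₁(τ,y)·c·Γ(τ,s)^{-1/2}·exp(−y²/(2Γ(τ,s))) satisfies the forward Kolmogorov equation ∂v'/∂τ(τ,y) = (1/2) h(τ)² ∂²v'/∂y²(τ,y) − ∂/∂y [ h(τ)² (1/y − y/Γ(τ,s)) v'(τ,y) ] on (0,s) × (0,∞). -/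
/-- The factor `k · exp(−y²/(2G))` solves `φ' = −(y/G) φ`. -/
lemma hasDerivAt_const_mul_exp_neg_sq_div {G : ℝ} (hG : G ≠ 0) (k y : ℝ) :
    HasDerivAt (fun y : ℝ => k * Real.exp (-y ^ 2 / (2 * G)))
      (-(y / G) * (k * Real.exp (-y ^ 2 / (2 * G)))) y := by
  have h1 : HasDerivAt (fun y : ℝ => -y ^ 2 / (2 * G)) (-(y / G)) y := by
    refine (((hasDerivAt_pow 2 y).neg).div_const (2 * G)).congr_deriv ?_
    field_simp
    norm_num
  exact (h1.exp.const_mul k).congr_deriv (by ring)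

/-- The derivative in `τ` of `Γ^{-1/2} · exp(−y²/(2Γ))` along a positive differentiable `Γ`. -/
lemma HasDerivAt.rpow_neg_half_mul_exp {Γ : ℝ → ℝ} {Γ' τ : ℝ} (hΓ : HasDerivAt Γ Γ' τ)
    (hpos : 0 < Γ τ) (y : ℝ) :
    HasDerivAt (fun τ => Γ τ ^ (-(1 : ℝ) / 2) * Real.exp (-y ^ 2 / (2 * Γ τ)))
      (Γ' * (-(1 / (2 * Γ τ)) + y ^ 2 / (2 * Γ τ ^ 2)) *
        (Γ τ ^ (-(1 : ℝ) / 2) * Real.exp (-y ^ 2 / (2 * Γ τ)))) τ := by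
  have hpow := hΓ.rpow_const (p := -(1 : ℝ) / 2) (Or.inl hpos.ne')
  have hexp : HasDerivAt (fun τ => -y ^ 2 / (2 * Γ τ)) (Γ' * (y ^ 2 / (2 * Γ τ ^ 2))) τ := by
    refine ((hasDerivAt_const τ (-y ^ 2)).div (hΓ.const_mul 2)
      (mul_ne_zero two_ne_zero hpos.ne')).congr_deriv ?_
    field_simp
    ring
  refine (hpow.mul hexp.exp).congr_deriv ?_
  rw [Real.rpow_sub_one hpos.ne']
  field_simp

/-- A function that is `C²` on an open set has its first two derivatives there. -/
lemma ContDiffOn.hasDerivAt_deriv_and_iteratedDeriv_two {f : ℝ → ℝ} {S : Set ℝ}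
    (hf : ContDiffOn ℝ 2 f S) (hS : IsOpen S) {y : ℝ} (hy : y ∈ S) :
    HasDerivAt f (deriv f y) y ∧ HasDerivAt (deriv f) (iteratedDeriv 2 f y) y := by
  refine ⟨((hf.differentiableOn two_ne_zero).differentiableAt (hS.mem_nhds hy)).hasDerivAt, ?_⟩
  have h1 : ContDiffOn ℝ 1 (deriv f) S := hf.deriv_of_isOpen hS (by norm_num)
  rw [iteratedDeriv_succ, iteratedDeriv_one]
  exact ((h1.differentiableOn one_ne_zero).differentiableAt (hS.mem_nhds hy)).hasDerivAt


/-- If `v₁` on `(0,s) × (0,∞)` satisfies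
`∂v₁/∂τ = (1/2)h(τ)² ∂²v₁/∂y² − h(τ)²(1/y)∂v₁/∂y + h(τ)²(1/y² + 1/Γ(τ,s))v₁`, then
`v'(τ,y) := v₁(τ,y) · c · Γ(τ,s)^{-1/2} · exp(−y²/(2Γ(τ,s)))`, with
`Γ(τ,s) = ∫_τ^s h(u)² du`, satisfies the forward Kolmogorov equation
`∂v'/∂τ = (1/2)h(τ)² ∂²v'/∂y² − ∂/∂y[h(τ)²(1/y − y/Γ(τ,s))v']` on `(0,s) × (0,∞)`. -/
theorem multiplicative_transform_forward_kolmogorov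
    (h : ℝ → ℝ) (hc : Continuous h) (hpos : ∀ u, 0 < h u)
    (s : ℝ) (hs : 0 < s) (c : ℝ)
    (v₁ : ℝ → ℝ → ℝ)
    (hreg_τ : ∀ y : ℝ, 0 < y → ContDiffOn ℝ 1 (fun τ => v₁ τ y) (Set.Ioo 0 s))
    (hreg_y : ∀ τ ∈ Set.Ioo (0 : ℝ) s, ContDiffOn ℝ 2 (fun y => v₁ τ y) (Set.Ioi 0))
    (hpde : ∀ τ ∈ Set.Ioo (0 : ℝ) s, ∀ y : ℝ, 0 < y →
      deriv (fun τ' => v₁ τ' y) τ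
        = (1 / 2) * (h τ) ^ 2 * iteratedDeriv 2 (fun y' => v₁ τ y') y
          - (h τ) ^ 2 * (1 / y) * deriv (fun y' => v₁ τ y') y
          + (h τ) ^ 2 * (1 / y ^ 2 + 1 / ∫ u in τ..s, (h u) ^ 2) * v₁ τ y)
    (v' : ℝ → ℝ → ℝ)
    (hv' : ∀ τ y, v' τ y =
      v₁ τ y * c * ((∫ u in τ..s, (h u) ^ 2) ^ (-(1 : ℝ) / 2)) *
        Real.exp (-y ^ 2 / (2 * ∫ u in τ..s, (h u) ^ 2))) :
    ∀ τ ∈ Set.Ioo (0 : ℝ) s, ∀ y : ℝ, 0 < y →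
      deriv (fun τ' => v' τ' y) τ
        = (1 / 2) * (h τ) ^ 2 * iteratedDeriv 2 (fun y' => v' τ y') y
          - deriv (fun y' =>
              (h τ) ^ 2 * (1 / y' - y' / ∫ u in τ..s, (h u) ^ 2) * v' τ y') y := by
  intro τ hτ y hy
  set Γ : ℝ → ℝ := fun t => ∫ u in t..s, (h u) ^ 2 with hΓdef
  have hcont : Continuous fun u => (h u) ^ 2 := hc.pow 2
  have hΓpos : 0 < Γ τ := intervalIntegral.intervalIntegral_pos_of_pos
    (hcont.intervalIntegrable _ _) (fun u => pow_pos (hpos u) 2) hτ.2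
  have hΓderiv : HasDerivAt Γ (-(h τ) ^ 2) τ :=
    intervalIntegral.integral_hasDerivAt_left (hcont.intervalIntegrable _ _)
      (hcont.stronglyMeasurableAtFilter _ _) hcont.continuousAt
  have hvτ : HasDerivAt (fun t => v₁ t y) (deriv (fun t => v₁ t y) τ) τ :=
    (((hreg_τ y hy).differentiableOn one_ne_zero).differentiableAt
      (isOpen_Ioo.mem_nhds hτ)).hasDerivAt
  have hv (z : ℝ) (hz : 0 < z) :=
    (hreg_y τ hτ).hasDerivAt_deriv_and_iteratedDeriv_two isOpen_Ioi (Set.mem_Ioi.mpr hz)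
  have hG : Γ τ ≠ 0 := hΓpos.ne'
  have hpdeτ := hpde τ hτ y hy
  change _ = _ - _ + (h τ) ^ 2 * (1 / y ^ 2 + 1 / Γ τ) * v₁ τ y at hpdeτ
  change _ = _ - deriv (fun y' => (h τ) ^ 2 * (1 / y' - y' / Γ τ) * v' τ y') y
  set k : ℝ := c * Γ τ ^ (-(1 : ℝ) / 2) with hk
  set φ : ℝ → ℝ := fun z => k * Real.exp (-z ^ 2 / (2 * Γ τ)) with hφ
  have hφ' (z : ℝ) : HasDerivAt φ (-(z / Γ τ) * φ z) z :=
    hasDerivAt_const_mul_exp_neg_sq_div hG k z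
  have hv'eq : (fun z => v' τ z) = fun z => v₁ τ z * φ z := by
    funext z
    rw [hv']
    simp only [hφ, hk, hΓdef]
    ring
  have hv'τ : HasDerivAt (fun t => v' t y) (deriv (fun t => v₁ t y) τ * φ y +
      v₁ τ y * (-(h τ) ^ 2 * (-(1 / (2 * Γ τ)) + y ^ 2 / (2 * Γ τ ^ 2)) * φ y)) τ := by
    have heq : (fun t => v' t y) = fun t => v₁ t y *
        (c * (Γ t ^ (-(1 : ℝ) / 2) * Real.exp (-y ^ 2 / (2 * Γ t)))) := by
      funext t
      rw [hv']
      simp only [hΓdef]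
      ring
    rw [heq]
    refine (hvτ.mul ((hΓderiv.rpow_neg_half_mul_exp hΓpos y).const_mul c)).congr_deriv ?_
    simp only [hφ, hk]
    ring
  have hv'y (z : ℝ) (hz : 0 < z) : HasDerivAt (fun z => v' τ z)
      (deriv (fun z => v₁ τ z) z * φ z + v₁ τ z * (-(z / Γ τ) * φ z)) z := by
    rw [hv'eq]
    exact (hv z hz).1.mul (hφ' z)
  have hv'yy : iteratedDeriv 2 (fun z => v' τ z) y =
      (iteratedDeriv 2 (fun z => v₁ τ z) y - 2 * (y / Γ τ) * deriv (fun z => v₁ τ z) y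
        + v₁ τ y * (y ^ 2 / Γ τ ^ 2 - 1 / Γ τ)) * φ y := by
    have hev : deriv (fun z => v' τ z) =ᶠ[nhds y]
        fun z => deriv (fun z => v₁ τ z) z * φ z + v₁ τ z * (-(z / Γ τ) * φ z) := by
      filter_upwards [isOpen_Ioi.mem_nhds hy] with z hz using (hv'y z hz).deriv
    rw [iteratedDeriv_succ, iteratedDeriv_one, hev.deriv_eq]
    refine (((hv y hy).2.mul (hφ' y)).add ((hv y hy).1.mul
      (((hasDerivAt_id y).div_const (Γ τ)).neg.mul (hφ' y)))).deriv.trans ?_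
    simp only [id, Pi.neg_apply, Pi.mul_apply]
    ring
  have hcoef : HasDerivAt (fun z : ℝ => (h τ) ^ 2 * (1 / z - z / Γ τ))
      ((h τ) ^ 2 * (-(1 / y ^ 2) - 1 / Γ τ)) y := by
    have hinv : HasDerivAt (fun z : ℝ => 1 / z) (-(1 / y ^ 2)) y := by
      simpa [one_div] using hasDerivAt_inv hy.ne'
    exact (hinv.sub ((hasDerivAt_id y).div_const (Γ τ))).const_mul _
  have hflux := (hcoef.mul (hv'y y hy)).deriv
  simp only [Pi.mul_def] at hflux
  rw [hv'τ.deriv, hv'yy, hflux, congrFun hv'eq y, hpdeτ]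
  field_simp
  ring
end

section
/- Let h : ℝ → ℝ be continuous with h(u) > 0 for all u, fix 0 < s, and for t ≤ r ≤ s set Γ(t,r) = ∫_t^r h(u)² du. For 0 ≤ t < τ < s and x, y > 0 define H(t,x;τ,y) := (2π Γ(t,τ))^{-1/2}[exp(−(y−x)²/(2Γ(t,τ))) − exp(−(y+x)²/(2Γ(t,τ)))] and G̃(t,x;τ,y) := (y/x)·(Γ(t,s)/Γ(τ,s))^{3/2}·exp(x²/(2Γ(t,s)) − y²/(2Γ(τ,s)))·H(t,x;τ,y). Then for fixed τ ∈ (0,s) and y > 0, G̃, as a function of (t,x), satisfies the backward Kolmogorov equation −∂G̃/∂t(t,x) = (1/2) h(t)² ∂²G̃/∂x²(t,x) + h(t)² (1/x − x/Γ(t,s)) ∂G̃/∂x(t,x) for all 0 ≤ t < τ and x > 0. -/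
/-- One Gaussian term of the bridge density, in terms of the values `a = Γ(t,s)`, `b = Γ(t,τ)` of the
clock, with the normalising constants `C`, `D` independent of `(t,x)`. -/
noncomputable def bridgeTerm (C D y a b x : ℝ) : ℝ :=
  (Real.sqrt (2 * Real.pi * b))⁻¹ * (x⁻¹ * (a / C) ^ ((3 : ℝ) / 2) *
    Real.exp (x ^ 2 / (2 * a) - D) * Real.exp (-(y - x) ^ 2 / (2 * b)))

theorem hasDerivAt_bridgeTerm_space (C D y : ℝ) {a b x : ℝ} (ha : 0 < a) (hb : 0 < b)
    (hx : 0 < x) :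
    HasDerivAt (fun x' => bridgeTerm C D y a b x')
      (bridgeTerm C D y a b x * (-1 / x + x / a + (y - x) / b)) x := by
  have h1 := hasDerivAt_inv hx.ne'
  have h2 := ((((hasDerivAt_id' x).fun_pow 2).div_const (2 * a)).sub_const D).exp
  have h3 := ((((hasDerivAt_id' x).const_sub y).fun_pow 2).fun_neg.div_const (2 * b)).exp
  have h4 := ((((h1.mul_const ((a / C) ^ ((3 : ℝ) / 2))).fun_mul h2).fun_mul h3).const_mul
    (Real.sqrt (2 * Real.pi * b))⁻¹)
  unfold bridgeTerm
  refine h4.congr_deriv ?_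
  generalize Real.exp _ = E₁
  generalize Real.exp _ = E₂
  generalize (Real.sqrt (2 * Real.pi * b))⁻¹ = S
  field_simp
  ring

theorem hasDerivAt_bridgeTerm_space_deriv (C D y : ℝ) {a b x : ℝ} (ha : 0 < a) (hb : 0 < b)
    (hx : 0 < x) :
    HasDerivAt (fun x' => bridgeTerm C D y a b x' * (-1 / x' + x' / a + (y - x') / b))
      (bridgeTerm C D y a b x *
        ((-1 / x + x / a + (y - x) / b) ^ 2 + (1 / x ^ 2 + 1 / a - 1 / b))) x := by
  have h1 := ((((hasDerivAt_const x (-1 : ℝ)).fun_div (hasDerivAt_id' x) hx.ne').fun_add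
    ((hasDerivAt_id' x).div_const a)).fun_add (((hasDerivAt_id' x).const_sub y).div_const b))
  refine ((hasDerivAt_bridgeTerm_space C D y ha hb hx).fun_mul h1).congr_deriv ?_
  field_simp
  ring

theorem hasDerivAt_bridgeTerm_time {C : ℝ} (hC : 0 < C) (D y x : ℝ) {A B : ℝ → ℝ} {k t : ℝ}
    (hA : HasDerivAt A (-k) t) (hB : HasDerivAt B (-k) t) (ha : 0 < A t) (hb : 0 < B t) :
    HasDerivAt (fun t' => bridgeTerm C D y (A t') (B t') x)
      (-k * (bridgeTerm C D y (A t) (B t) x *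
        (3 / (2 * A t) - x ^ 2 / (2 * A t ^ 2) - 1 / (2 * B t)
          + (y - x) ^ 2 / (2 * B t ^ 2)))) t := by
  have hπ := Real.pi_pos
  have hpb : 0 < 2 * Real.pi * B t := by positivity
  have hS := ((hB.const_mul (2 * Real.pi)).sqrt hpb.ne').fun_inv (Real.sqrt_pos.2 hpb).ne'
  have hR := (hA.div_const C).rpow_const (p := (3 : ℝ) / 2) (Or.inl (div_pos ha hC).ne')
  have hE₁ := ((((hasDerivAt_const t (x ^ 2)).fun_div (hA.const_mul 2)
    (by positivity)).sub_const D).exp)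
  have hE₂ := ((hasDerivAt_const t (-(y - x) ^ 2)).fun_div (hB.const_mul 2)
    (by positivity)).exp
  have hall := hS.fun_mul (((hR.const_mul x⁻¹).fun_mul hE₁).fun_mul hE₂)
  unfold bridgeTerm
  refine hall.congr_deriv ?_
  have hpow : (A t / C) ^ ((3 : ℝ) / 2 - 1) = (A t / C) ^ ((3 : ℝ) / 2) * (C / A t) := by
    rw [Real.rpow_sub_one (div_pos ha hC).ne']
    field_simp
  have hsq : Real.sqrt (2 * Real.pi * B t) ^ 2 = 2 * Real.pi * B t := Real.sq_sqrt hpb.le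
  have hsqrt : -(2 * Real.pi * -k / (2 * Real.sqrt (2 * Real.pi * B t))) /
      Real.sqrt (2 * Real.pi * B t) ^ 2 =
      (Real.sqrt (2 * Real.pi * B t))⁻¹ * (k / (2 * B t)) := by
    rw [hsq]
    have := (Real.sqrt_pos.2 hpb).ne'
    field_simp
  rw [hpow, hsqrt]
  generalize Real.exp _ = E₁
  generalize Real.exp _ = E₂
  generalize (Real.sqrt (2 * Real.pi * B t))⁻¹ = S
  generalize (A t / C) ^ ((3 : ℝ) / 2) = R
  generalize x⁻¹ = X
  field_simp
  ring

theorem hasDerivAt_integral_sq_left {h : ℝ → ℝ} (hc : Continuous h) (r t : ℝ) :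
    HasDerivAt (fun t' => ∫ u in t'..r, (h u) ^ 2) (-(h t) ^ 2) t :=
  intervalIntegral.integral_hasDerivAt_left ((hc.pow 2).intervalIntegrable _ _)
    (hc.pow 2).aestronglyMeasurable.stronglyMeasurableAtFilter (hc.pow 2).continuousAt

theorem integral_sq_pos {h : ℝ → ℝ} (hc : Continuous h) (hpos : ∀ u, 0 < h u) {t r : ℝ}
    (htr : t < r) : 0 < ∫ u in t..r, (h u) ^ 2 :=
  intervalIntegral.intervalIntegral_pos_of_pos ((hc.pow 2).intervalIntegrable _ _)
    (fun u => pow_pos (hpos u) 2) htr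

/-- With `Γ(t,r) = ∫_t^r h(u)² du`, the absorbed heat kernel
`H(t,x;τ,y) = (2πΓ(t,τ))^{-1/2}[exp(−(y−x)²/(2Γ(t,τ))) − exp(−(y+x)²/(2Γ(t,τ)))]`
and the transition density of the Bessel-bridge-type process
`G̃(t,x;τ,y) = (y/x)·(Γ(t,s)/Γ(τ,s))^{3/2}·exp(x²/(2Γ(t,s)) − y²/(2Γ(τ,s)))·H(t,x;τ,y)`,
`G̃` as a function of the backward variables `(t,x)` satisfies
`−∂G̃/∂t = (1/2)h(t)² ∂²G̃/∂x² + h(t)²(1/x − x/Γ(t,s))∂G̃/∂x` for `0 ≤ t < τ`, `x > 0`. -/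
theorem bessel_bridge_density_backward_kolmogorov
    (h : ℝ → ℝ) (hc : Continuous h) (hpos : ∀ u, 0 < h u)
    (s : ℝ) (hs : 0 < s)
    (H : ℝ → ℝ → ℝ → ℝ → ℝ)
    (hH : ∀ t x τ y, H t x τ y =
      (Real.sqrt (2 * Real.pi * ∫ u in t..τ, (h u) ^ 2))⁻¹ *
        (Real.exp (-(y - x) ^ 2 / (2 * ∫ u in t..τ, (h u) ^ 2))
          - Real.exp (-(y + x) ^ 2 / (2 * ∫ u in t..τ, (h u) ^ 2))))
    (G : ℝ → ℝ → ℝ → ℝ → ℝ)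
    (hG : ∀ t x τ y, G t x τ y =
      (y / x) * ((∫ u in t..s, (h u) ^ 2) / ∫ u in τ..s, (h u) ^ 2) ^ ((3 : ℝ) / 2) *
        Real.exp (x ^ 2 / (2 * ∫ u in t..s, (h u) ^ 2)
          - y ^ 2 / (2 * ∫ u in τ..s, (h u) ^ 2)) * H t x τ y) :
    ∀ τ ∈ Set.Ioo (0 : ℝ) s, ∀ y : ℝ, 0 < y →
      ∀ t, 0 ≤ t → t < τ → ∀ x : ℝ, 0 < x →
        -deriv (fun t' => G t' x τ y) t
          = (1 / 2) * (h t) ^ 2 * iteratedDeriv 2 (fun x' => G t x' τ y) x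
            + (h t) ^ 2 * (1 / x - x / ∫ u in t..s, (h u) ^ 2)
                * deriv (fun x' => G t x' τ y) x := by
  rintro τ ⟨-, hτs⟩ y - t - htτ x hx
  have hA := hasDerivAt_integral_sq_left hc s t
  have hB := hasDerivAt_integral_sq_left hc τ t
  have ha := integral_sq_pos hc hpos (htτ.trans hτs)
  have hb := integral_sq_pos hc hpos htτ
  have hC := integral_sq_pos hc hpos hτs
  set C := ∫ u in τ..s, (h u) ^ 2
  have hGterm : ∀ t' x', G t' x' τ y =
      y * (bridgeTerm C (y ^ 2 / (2 * C)) y (∫ u in t'..s, (h u) ^ 2) (∫ u in t'..τ, (h u) ^ 2) x'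
        - bridgeTerm C (y ^ 2 / (2 * C)) (-y) (∫ u in t'..s, (h u) ^ 2)
          (∫ u in t'..τ, (h u) ^ 2) x') := by
    intro t' x'
    rw [hG, hH, bridgeTerm, bridgeTerm, show (-y - x') ^ 2 = (y + x') ^ 2 by ring]
    ring
  simp only [hGterm]
  have ht := ((hasDerivAt_bridgeTerm_time hC (y ^ 2 / (2 * C)) y x hA hB ha hb).fun_sub
    (hasDerivAt_bridgeTerm_time hC (y ^ 2 / (2 * C)) (-y) x hA hB ha hb)).const_mul y
  rw [ht.deriv]
  clear ht hGterm hA hB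
  generalize (∫ u in t..s, (h u) ^ 2) = a at *
  generalize (∫ u in t..τ, (h u) ^ 2) = b at *
  have hd : ∀ x' : ℝ, 0 < x' → _ := fun x' hx' =>
    ((hasDerivAt_bridgeTerm_space C (y ^ 2 / (2 * C)) y ha hb hx').fun_sub
      (hasDerivAt_bridgeTerm_space C (y ^ 2 / (2 * C)) (-y) ha hb hx')).const_mul y
  have hdd := ((hasDerivAt_bridgeTerm_space_deriv C (y ^ 2 / (2 * C)) y ha hb hx).fun_sub
    (hasDerivAt_bridgeTerm_space_deriv C (y ^ 2 / (2 * C)) (-y) ha hb hx)).const_mul y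
  have heq := (lt_mem_nhds hx).mono fun x' hx' => (hd x' hx').deriv
  rw [iteratedDeriv_succ, iteratedDeriv_one, Filter.EventuallyEq.deriv_eq heq, hdd.deriv,
    (hd x hx).deriv]
  generalize bridgeTerm C (y ^ 2 / (2 * C)) y a b x = g₁
  generalize bridgeTerm C (y ^ 2 / (2 * C)) (-y) a b x = g₂
  field_simp
  ring
end

section
/- Let h : ℝ → ℝ be continuous with h(u) > 0 for all u, fix 0 < s, and for t ≤ r ≤ s set Γ(t,r) = ∫_t^r h(u)² du. For 0 ≤ t < τ < s and x, y > 0 define H(t,x;τ,y) := (2π Γ(t,τ))^{-1/2}[exp(−(y−x)²/(2Γ(t,τ))) − exp(−(y+x)²/(2Γ(t,τ)))] and G̃(t,x;τ,y) := (y/x)·(Γ(t,s)/Γ(τ,s))^{3/2}·exp(x²/(2Γ(t,s)) − y²/(2Γ(τ,s)))·H(t,x;τ,y). Then for fixed t ∈ [0,s) and x > 0, G̃, as a function of (τ,y), satisfies the forward Kolmogorov equation ∂G̃/∂τ(τ,y) = (1/2) h(τ)² ∂²G̃/∂y²(τ,y) − ∂/∂y [ h(τ)² (1/y − y/Γ(τ,s))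 G̃(τ,y) ] for all t < τ < s and y > 0. -/
/-- Space derivative of the heat kernel. -/
theorem hasDerivAt_heatKernel_space_s13 (c a x y : ℝ) :
    HasDerivAt (fun y => c * Real.exp (-(y - x) ^ 2 / (2 * a)))
      (c * (-(y - x) / a) * Real.exp (-(y - x) ^ 2 / (2 * a))) y := by
  have h1 : HasDerivAt (fun y : ℝ => -(y - x) ^ 2 / (2 * a)) (-(y - x) / a) y := by
    refine ((((hasDerivAt_id y).sub_const x).pow 2).neg.div_const (2 * a)).congr_deriv ?_
    simp
    ring
  exact (h1.exp.const_mul c).congr_deriv (by ring)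

/-- Second space derivative of the heat kernel. -/
theorem hasDerivAt_heatKernel_space_deriv (c a x y : ℝ) :
    HasDerivAt (fun y => c * (-(y - x) / a) * Real.exp (-(y - x) ^ 2 / (2 * a)))
      (c * ((y - x) ^ 2 / a ^ 2 - 1 / a) * Real.exp (-(y - x) ^ 2 / (2 * a))) y := by
  have h1 : HasDerivAt (fun y : ℝ => -(y - x) / a) (-1 / a) y :=
    ((hasDerivAt_id y).sub_const x).neg.div_const a
  have h2 := h1.mul (hasDerivAt_heatKernel_space_s13 c a x y)
  refine (h2.congr_deriv ?_).congr_of_eventuallyEq (Filter.Eventually.of_forall fun z => ?_)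
  · ring
  · simp only [Pi.mul_apply]
    ring

/-- Time derivative of the heat kernel. -/
theorem hasDerivAt_heatKernel_time {a : ℝ} (ha : 0 < a) (x y : ℝ) :
    HasDerivAt (fun a => (Real.sqrt (2 * Real.pi * a))⁻¹ * Real.exp (-(y - x) ^ 2 / (2 * a)))
      (1 / 2 * ((Real.sqrt (2 * Real.pi * a))⁻¹ * ((y - x) ^ 2 / a ^ 2 - 1 / a) *
        Real.exp (-(y - x) ^ 2 / (2 * a)))) a := by
  have hp : 0 < 2 * Real.pi * a := by positivity
  have hs := Real.sqrt_pos.2 hp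
  have hsq : Real.sqrt (2 * Real.pi * a) ^ 2 = 2 * Real.pi * a := Real.sq_sqrt hp.le
  have h1 : HasDerivAt (fun a => (Real.sqrt (2 * Real.pi * a))⁻¹)
      (-(Real.sqrt (2 * Real.pi * a))⁻¹ / (2 * a)) a := by
    refine ((((hasDerivAt_id a).const_mul (2 * Real.pi)).sqrt hp.ne').inv hs.ne').congr_deriv ?_
    simp only [id]
    rw [hsq]
    field_simp
  have h2 : HasDerivAt (fun a => -(y - x) ^ 2 / (2 * a)) ((y - x) ^ 2 / (2 * a ^ 2)) a := by
    refine ((hasDerivAt_const a (-(y - x) ^ 2)).div ((hasDerivAt_id a).const_mul 2)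
      (by simpa using ha.ne')).congr_deriv ?_
    simp only [id]
    field_simp
    ring
  refine (h1.mul h2.exp).congr_deriv ?_
  field_simp
  ring

/-- Space derivative of the (normalised) first-passage density. -/
theorem hasDerivAt_passage_space (c x e b y : ℝ) :
    HasDerivAt (fun y => y / x * c * Real.exp (e - y ^ 2 / (2 * b)))
      (c / x * (1 - y ^ 2 / b) * Real.exp (e - y ^ 2 / (2 * b))) y := by
  have h1 : HasDerivAt (fun y : ℝ => e - y ^ 2 / (2 * b)) (-(y / b)) y := by
    refine ((((hasDerivAt_id y).pow 2).div_const (2 * b)).const_sub e).congr_deriv ?_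
    simp
    ring
  refine ((((hasDerivAt_id y).div_const x).mul_const c).mul h1.exp).congr_deriv ?_
  simp only [id]
  ring

/-- Second space derivative of the first-passage density. -/
theorem hasDerivAt_passage_space_deriv (c x e b y : ℝ) :
    HasDerivAt (fun y => c / x * (1 - y ^ 2 / b) * Real.exp (e - y ^ 2 / (2 * b)))
      (c / x * (y ^ 3 / b ^ 2 - 3 * y / b) * Real.exp (e - y ^ 2 / (2 * b))) y := by
  have h1 : HasDerivAt (fun y : ℝ => e - y ^ 2 / (2 * b)) (-(y / b)) y := by
    refine ((((hasDerivAt_id y).pow 2).div_const (2 * b)).const_sub e).congr_deriv ?_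
    simp
    ring
  have h2 : HasDerivAt (fun y : ℝ => c / x * (1 - y ^ 2 / b)) (c / x * (-(2 * y / b))) y := by
    refine (((((hasDerivAt_id y).pow 2).div_const b).const_sub 1).const_mul (c / x)).congr_deriv ?_
    simp
  refine (h2.mul h1.exp).congr_deriv ?_
  ring

/-- The first-passage density solves the heat equation in its time-to-go variable. -/
theorem hasDerivAt_passage_time {T b : ℝ} (hT : 0 < T) (hb : 0 < b) (x e y : ℝ) :
    HasDerivAt (fun b => y / x * (T / b) ^ ((3 : ℝ) / 2) * Real.exp (e - y ^ 2 / (2 * b)))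
      (1 / 2 * ((T / b) ^ ((3 : ℝ) / 2) / x * (y ^ 3 / b ^ 2 - 3 * y / b) *
        Real.exp (e - y ^ 2 / (2 * b)))) b := by
  have hq : 0 < T / b := by positivity
  have h0 : HasDerivAt (fun b => T / b) (-T / b ^ 2) b := by
    refine ((hasDerivAt_const b T).div (hasDerivAt_id b) hb.ne').congr_deriv ?_
    simp
  have h1 : HasDerivAt (fun b => (T / b) ^ ((3 : ℝ) / 2))
      (-(3 / 2) * (T / b) ^ ((3 : ℝ) / 2) / b) b := by
    refine (h0.rpow_const (p := (3 : ℝ) / 2) (Or.inl hq.ne')).congr_deriv ?_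
    rw [Real.rpow_sub_one hq.ne']
    field_simp
  have h2 : HasDerivAt (fun b => e - y ^ 2 / (2 * b)) (y ^ 2 / (2 * b ^ 2)) b := by
    refine (((hasDerivAt_const b (y ^ 2)).div ((hasDerivAt_id b).const_mul 2)
      (by simpa using hb.ne')).const_sub e).congr_deriv ?_
    simp only [id]
    field_simp
    ring
  refine ((h1.const_mul (y / x)).mul h2.exp).congr_deriv ?_
  ring

/-- If `u` solves the backward and `v` the forward heat equation, both with diffusivity `k / 2`,
then `u * v` solves the forward Kolmogorov equation with drift `k * (log u)'`. -/
theorem forward_kolmogorov_of_doob_transform {u v : ℝ → ℝ → ℝ} {u₁ u₂ v₁ v₂ b : ℝ → ℝ}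
    {k τ y : ℝ}
    (hu₁ : ∀ z, HasDerivAt (u τ) (u₁ z) z) (hu₂ : ∀ z, HasDerivAt u₁ (u₂ z) z)
    (hv₁ : ∀ z, HasDerivAt (v τ) (v₁ z) z) (hv₂ : ∀ z, HasDerivAt v₁ (v₂ z) z)
    (hu : HasDerivAt (fun r => u r y) (-(k / 2 * u₂ y)) τ)
    (hv : HasDerivAt (fun r => v r y) (k / 2 * v₂ y) τ)
    (hb : ∀ᶠ z in nhds y, b z * u τ z = k * u₁ z) :
    deriv (fun r => u r y * v r y) τ =
      1 / 2 * k * iteratedDeriv 2 (fun z => u τ z * v τ z) y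
        - deriv (fun z => b z * (u τ z * v τ z)) y := by
  have h1 : deriv (fun z => u τ z * v τ z) = fun z => u₁ z * v τ z + u τ z * v₁ z :=
    funext fun z => ((hu₁ z).mul (hv₁ z)).deriv
  have h2 : iteratedDeriv 2 (fun z => u τ z * v τ z) y =
      (u₂ y * v τ y + u₁ y * v₁ y) + (u₁ y * v₁ y + u τ y * v₂ y) := by
    rw [iteratedDeriv_succ, iteratedDeriv_one, h1]
    exact (((hu₂ y).mul (hv₁ y)).add ((hu₁ y).mul (hv₂ y))).deriv
  have h3 : (fun z => b z * (u τ z * v τ z)) =ᶠ[nhds y] fun z => k * (u₁ z * v τ z) := by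
    filter_upwards [hb] with z hz
    rw [← mul_assoc, hz, mul_assoc]
  have h4 : deriv (fun z => k * (u₁ z * v τ z)) y = k * (u₂ y * v τ y + u₁ y * v₁ y) :=
    (((hu₂ y).mul (hv₁ y)).const_mul k).deriv
  have h5 : deriv (fun r => u r y * v r y) τ =
      -(k / 2 * u₂ y) * v τ y + u τ y * (k / 2 * v₂ y) := (hu.mul hv).deriv
  rw [h2, h3.deriv_eq, h4, h5]
  ring


/-- With `Γ(t,r) = ∫_t^r h(u)² du`, the absorbed heat kernel
`H(t,x;τ,y) = (2πΓ(t,τ))^{-1/2}[exp(−(y−x)²/(2Γ(t,τ))) − exp(−(y+x)²/(2Γ(t,τ)))]`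
and the transition density of the Bessel-bridge-type process
`G̃(t,x;τ,y) = (y/x)·(Γ(t,s)/Γ(τ,s))^{3/2}·exp(x²/(2Γ(t,s)) − y²/(2Γ(τ,s)))·H(t,x;τ,y)`,
`G̃` as a function of the forward variables `(τ,y)` satisfies
`∂G̃/∂τ = (1/2)h(τ)² ∂²G̃/∂y² − ∂/∂y[h(τ)²(1/y − y/Γ(τ,s))G̃]` for `t < τ < s`, `y > 0`. -/
theorem bessel_bridge_density_forward_kolmogorov
    (h : ℝ → ℝ) (hc : Continuous h) (hpos : ∀ u, 0 < h u)
    (s : ℝ) (hs : 0 < s)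
    (H : ℝ → ℝ → ℝ → ℝ → ℝ)
    (hH : ∀ t x τ y, H t x τ y =
      (Real.sqrt (2 * Real.pi * ∫ u in t..τ, (h u) ^ 2))⁻¹ *
        (Real.exp (-(y - x) ^ 2 / (2 * ∫ u in t..τ, (h u) ^ 2))
          - Real.exp (-(y + x) ^ 2 / (2 * ∫ u in t..τ, (h u) ^ 2))))
    (G : ℝ → ℝ → ℝ → ℝ → ℝ)
    (hG : ∀ t x τ y, G t x τ y =
      (y / x) * ((∫ u in t..s, (h u) ^ 2) / ∫ u in τ..s, (h u) ^ 2) ^ ((3 : ℝ) / 2) *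
        Real.exp (x ^ 2 / (2 * ∫ u in t..s, (h u) ^ 2)
          - y ^ 2 / (2 * ∫ u in τ..s, (h u) ^ 2)) * H t x τ y) :
    ∀ t ∈ Set.Ico (0 : ℝ) s, ∀ x : ℝ, 0 < x →
      ∀ τ, t < τ → τ < s → ∀ y : ℝ, 0 < y →
        deriv (fun τ' => G t x τ' y) τ
          = (1 / 2) * (h τ) ^ 2 * iteratedDeriv 2 (fun y' => G t x τ y') y
            - deriv (fun y' =>
                (h τ) ^ 2 * (1 / y' - y' / ∫ u in τ..s, (h u) ^ 2) * G t x τ y') y := by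
  intro t _ x hx τ htτ hτs y hy
  have hc2 : Continuous fun u => h u ^ 2 := hc.pow 2
  have hint : ∀ p q : ℝ, IntervalIntegrable (fun u => h u ^ 2) MeasureTheory.volume p q :=
    fun p q => hc2.intervalIntegrable p q
  have hΓ : ∀ p q : ℝ, p < q → 0 < ∫ u in p..q, h u ^ 2 := fun p q hpq =>
    intervalIntegral.intervalIntegral_pos_of_pos (hint p q) (fun u => pow_pos (hpos u) 2) hpq
  have hA' : HasDerivAt (fun r => ∫ u in t..r, h u ^ 2) (h τ ^ 2) τ :=
    intervalIntegral.integral_hasDerivAt_right (hint t τ)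
      hc2.stronglyMeasurable.stronglyMeasurableAtFilter hc2.continuousAt
  have hB' : HasDerivAt (fun r => ∫ u in r..s, h u ^ 2) (-(h τ ^ 2)) τ :=
    intervalIntegral.integral_hasDerivAt_left (hint τ s)
      hc2.stronglyMeasurable.stronglyMeasurableAtFilter hc2.continuousAt
  have hT := hΓ t s (htτ.trans hτs)
  have hA := hΓ t τ htτ
  have hB := hΓ τ s hτs
  simp only [hG]
  generalize (∫ u in t..s, h u ^ 2) = T at hT ⊢
  refine forward_kolmogorov_of_doob_transform
    (u := fun r z => z / x * (T / ∫ u in r..s, h u ^ 2) ^ ((3 : ℝ) / 2) *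
      Real.exp (x ^ 2 / (2 * T) - z ^ 2 / (2 * ∫ u in r..s, h u ^ 2)))
    (v := fun r z => H t x r z)
    (fun z => hasDerivAt_passage_space _ x _ _ z)
    (fun z => hasDerivAt_passage_space_deriv _ x _ _ z)
    (v₁ := fun z => (Real.sqrt (2 * Real.pi * ∫ u in t..τ, h u ^ 2))⁻¹ *
        (-(z - x) / ∫ u in t..τ, h u ^ 2) *
          Real.exp (-(z - x) ^ 2 / (2 * ∫ u in t..τ, h u ^ 2))
      - (Real.sqrt (2 * Real.pi * ∫ u in t..τ, h u ^ 2))⁻¹ *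
        (-(z - -x) / ∫ u in t..τ, h u ^ 2) *
          Real.exp (-(z - -x) ^ 2 / (2 * ∫ u in t..τ, h u ^ 2)))
    (fun z => ?_)
    (fun z => (hasDerivAt_heatKernel_space_deriv _ _ x z).sub
      (hasDerivAt_heatKernel_space_deriv _ _ (-x) z)) ?_ ?_ ?_
  · refine ((hasDerivAt_heatKernel_space_s13 _ _ x z).sub
      (hasDerivAt_heatKernel_space_s13 _ _ (-x) z)).congr_of_eventuallyEq
        (Filter.Eventually.of_forall fun w => ?_)
    simp only [hH, Pi.sub_apply, sub_neg_eq_add]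
    ring
  · refine ((hasDerivAt_passage_time hT hB x (x ^ 2 / (2 * T)) y).comp τ hB').congr_deriv ?_
    ring
  · refine ((((hasDerivAt_heatKernel_time hA x y).sub
      (hasDerivAt_heatKernel_time hA (-x) y)).comp τ hA').congr_deriv
        (by ring)).congr_of_eventuallyEq (Filter.Eventually.of_forall fun w => ?_)
    simp only [hH, Function.comp_apply, Pi.sub_apply, sub_neg_eq_add]
    ring
  · filter_upwards [lt_mem_nhds hy] with z hz
    field_simp
end
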